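/- Let n ≥ 1 be an integer, let 0 < m < n, σ > 0 and κ > n − σ be real numbers, and let 0 < s ≤ n. Let μ be a compactly supported Borel probability measure on ℝ^n for which there are constants C₁, c > 0 with |μ̂(ξ)| ≤ C₁|ξ|^{−σ} for all ξ ≠ 0 and μ(B(x,r)) ≥ c r^m for every x ∈ supp μ and every 0 < r ≤ 1. Let λ be a Borel probability measure on ℝ^n which is AD-regular with exponent s and satisfies ∫_{|ξ|≤R} |λ̂(ξ)| dξ ≤ C₂ R^{n−κ} for all R ≥ 1 and some C₂ > 0. Then there exists C > 0 such that for every δ ∈ (0,1) the set (supp μ)^δ ∩ supp λ can be covered by C · δ^{−(s−(n−m))} closed balls of radius δ. In particular, the upper box dimension of supp μ ∩ supp λ is at most max{0, s − (n − m)}. -/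

import Mathlib

open MeasureTheory Metric Filter Set
open scoped ENNReal NNReal Real Topology

noncomputable section

/-- The Fourier transform of a measure on ℝⁿ: `μ̂(ξ) = ∫ e^{-2πi⟨x,ξ⟩} dμ(x)`. -/
def mft {n : ℕ} (μ : Measure (EuclideanSpace ℝ (Fin n))) (ξ : EuclideanSpace ℝ (Fin n)) : ℂ :=
  ∫ x, Complex.exp ((((-(2 * Real.pi * (inner ℝ x ξ : ℝ))) : ℝ) : ℂ) * Complex.I) ∂μ

/-- The support of a measure on a metric space. -/
def msupp {X : Type*} [PseudoMetricSpace X] [MeasurableSpace X] (μ : Measure X) : Set X :=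
  {x | ∀ r : ℝ, 0 < r → 0 < μ (Metric.ball x r)}

/-- A measure is AD-regular with exponent `s`: `C⁻¹ rˢ ≤ μ(B(x,r)) ≤ C rˢ` for `x` in the
support and `0 < r ≤ 1`. -/
def ADRegular {X : Type*} [PseudoMetricSpace X] [MeasurableSpace X]
    (μ : Measure X) (s : ℝ) : Prop :=
  ∃ C : ℝ, 1 < C ∧ ∀ x ∈ msupp μ, ∀ r : ℝ, 0 < r → r ≤ 1 →
    ENNReal.ofReal (C⁻¹ * r ^ s) ≤ μ (Metric.closedBall x r) ∧
      μ (Metric.closedBall x r) ≤ ENNReal.ofReal (C * r ^ s)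

/-- The minimal number of closed `δ`-balls needed to cover `F` (0 if no finite cover exists). -/
def coverNum {X : Type*} [PseudoMetricSpace X] (F : Set X) (δ : ℝ) : ℕ :=
  sInf {N : ℕ | ∃ S : Finset X, S.card = N ∧ F ⊆ ⋃ x ∈ S, Metric.closedBall x δ}

/-- The upper box dimension, `limsup_{δ→0⁺} log N_δ(F) / log (1/δ)`. -/
def upperBoxDim {X : Type*} [PseudoMetricSpace X] (F : Set X) : ℝ :=
  Filter.limsup (fun δ : ℝ => Real.log (coverNum F δ) / Real.log (1 / δ))
    (nhdsWithin 0 (Set.Ioi (0 : ℝ)))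

lemma mft_eq_charFun {n : ℕ} (μ : Measure (EuclideanSpace ℝ (Fin n)))
    (ξ : EuclideanSpace ℝ (Fin n)) : mft μ ξ = charFun μ ((-(2 * Real.pi)) • ξ) := by
  simp only [mft, charFun_apply, inner_smul_right]
  congr 1; ext x; congr 3; ring

lemma mft_cont {n : ℕ} (μ : Measure (EuclideanSpace ℝ (Fin n))) [IsProbabilityMeasure μ] :
    Continuous (mft μ) := by
  have : mft μ = fun ξ => charFun μ ((-(2 * Real.pi)) • ξ) := funext (mft_eq_charFun μ)
  rw [this]
  exact continuous_charFun.comp (by fun_prop)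

lemma mft_norm_le {n : ℕ} (μ : Measure (EuclideanSpace ℝ (Fin n))) [IsProbabilityMeasure μ]
    (ξ : EuclideanSpace ℝ (Fin n)) : ‖mft μ ξ‖ ≤ 1 := by
  rw [mft_eq_charFun]; exact norm_charFun_le_one _

lemma mft_conj {n : ℕ} (μ : Measure (EuclideanSpace ℝ (Fin n)))
    (ξ : EuclideanSpace ℝ (Fin n)) :
    ∫ x, Complex.exp ((((2 * Real.pi * (inner ℝ x ξ : ℝ)) : ℝ) : ℂ) * Complex.I) ∂μ
      = (starRingEnd ℂ) (mft μ ξ) := by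
  rw [mft_eq_charFun, ← charFun_neg, charFun_apply]
  congr 1; ext x; congr 3
  rw [inner_neg_right, inner_smul_right]; ring

lemma gauss_id {n : ℕ} (δ : ℝ) (hδ : 0 < δ) (x y : EuclideanSpace ℝ (Fin n)) :
    ∫ ξ : EuclideanSpace ℝ (Fin n), ((Real.exp (-(Real.pi * δ ^ 2) * ‖ξ‖ ^ 2) : ℝ) : ℂ) *
      (Complex.exp ((((-(2 * Real.pi * (inner ℝ x ξ : ℝ))) : ℝ) : ℂ) * Complex.I) *
       Complex.exp ((((2 * Real.pi * (inner ℝ y ξ : ℝ)) : ℝ) : ℂ) * Complex.I))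
    = (((δ ^ n)⁻¹ * Real.exp (-(Real.pi * ‖x - y‖ ^ 2 / δ ^ 2)) : ℝ) : ℂ) := by
  have hb : 0 < (((Real.pi * δ ^ 2 : ℝ) : ℂ)).re := by
    rw [Complex.ofReal_re]; positivity
  have h := GaussianFourier.integral_cexp_neg_mul_sq_norm_add hb (-(2 * Real.pi * Complex.I))
    (x - y)
  have h1 : ((Real.pi : ℂ) / ((Real.pi * δ ^ 2 : ℝ) : ℂ)) ^
      ((Module.finrank ℝ (EuclideanSpace ℝ (Fin n)) : ℂ) / 2) = (((δ ^ n)⁻¹ : ℝ) : ℂ) := by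
    have e1 : ((Real.pi : ℂ) / ((Real.pi * δ ^ 2 : ℝ) : ℂ)) = (((δ ^ 2)⁻¹ : ℝ) : ℂ) := by
      rw [← Complex.ofReal_div]; congr 1; field_simp
    have e2 : ((Module.finrank ℝ (EuclideanSpace ℝ (Fin n)) : ℂ) / 2) = (((n : ℝ) / 2 : ℝ) : ℂ) := by
      simp
    rw [e1, e2, ← Complex.ofReal_cpow (by positivity)]
    congr 1
    rw [Real.inv_rpow (by positivity), ← Real.rpow_natCast δ 2, ← Real.rpow_mul hδ.le,
      ← Real.rpow_natCast δ n]
    congr 2; push_cast; ring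
  rw [h1] at h
  rw [Complex.ofReal_mul, Complex.ofReal_exp]
  convert h using 2
  · ext ξ
    rw [Complex.ofReal_exp, ← Complex.exp_add, ← Complex.exp_add, inner_sub_left]
    congr 1; push_cast; ring
  · congr 1
    have : (δ : ℂ) ≠ 0 := by exact_mod_cast hδ.ne'
    have : (Real.pi : ℂ) ≠ 0 := by exact_mod_cast Real.pi_ne_zero
    push_cast
    field_simp
    rw [Complex.I_sq]; ring

lemma gauss_le {n : ℕ} (μ lam : Measure (EuclideanSpace ℝ (Fin n)))
    [IsProbabilityMeasure μ] [IsProbabilityMeasure lam]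
    (hint : Integrable (fun ξ => ‖mft μ ξ‖ * ‖mft lam ξ‖)) (δ : ℝ) (hδ : 0 < δ) :
    ∫ z : EuclideanSpace ℝ (Fin n) × EuclideanSpace ℝ (Fin n),
      (δ ^ n)⁻¹ * Real.exp (-(Real.pi * ‖z.1 - z.2‖ ^ 2 / δ ^ 2)) ∂(μ.prod lam)
      ≤ ∫ ξ, ‖mft μ ξ‖ * ‖mft lam ξ‖ := by
  set f : EuclideanSpace ℝ (Fin n) × EuclideanSpace ℝ (Fin n) → EuclideanSpace ℝ (Fin n) → ℂ :=
    fun z ξ => ((Real.exp (-(Real.pi * δ ^ 2) * ‖ξ‖ ^ 2) : ℝ) : ℂ) *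
      (Complex.exp ((((-(2 * Real.pi * (inner ℝ z.1 ξ : ℝ))) : ℝ) : ℂ) * Complex.I) *
       Complex.exp ((((2 * Real.pi * (inner ℝ z.2 ξ : ℝ)) : ℝ) : ℂ) * Complex.I)) with hf
  have hg : Integrable (fun ξ : EuclideanSpace ℝ (Fin n) =>
      Real.exp (-(Real.pi * δ ^ 2) * ‖ξ‖ ^ 2)) := by
    have hb : 0 < (((Real.pi * δ ^ 2 : ℝ) : ℂ)).re := by
      rw [Complex.ofReal_re]; positivity
    have h := (GaussianFourier.integrable_cexp_neg_mul_sq_norm_add hb 0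
      (0 : EuclideanSpace ℝ (Fin n))).norm
    refine h.congr (Eventually.of_forall fun ξ => ?_)
    simp only [zero_mul, add_zero]
    rw [Complex.norm_exp]
    congr 1
    rw [← Complex.ofReal_pow, ← Complex.ofReal_neg, ← Complex.ofReal_mul, Complex.ofReal_re]
  have hfi : Integrable (Function.uncurry f) ((μ.prod lam).prod volume) := by
    have h2 : Integrable (fun p : (EuclideanSpace ℝ (Fin n) × EuclideanSpace ℝ (Fin n)) ×
        EuclideanSpace ℝ (Fin n) => Real.exp (-(Real.pi * δ ^ 2) * ‖p.2‖ ^ 2))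
        ((μ.prod lam).prod volume) := hg.comp_snd (μ.prod lam)
    refine h2.mono' ?_ (Eventually.of_forall fun p => ?_)
    · apply Continuous.aestronglyMeasurable
      simp only [hf, Function.uncurry_def]
      fun_prop
    · simp only [hf, Function.uncurry_def]
      rw [norm_mul, norm_mul, Complex.norm_exp_ofReal_mul_I, Complex.norm_exp_ofReal_mul_I,
        Complex.norm_real, Real.norm_eq_abs, abs_of_pos (Real.exp_pos _)]
      simp
  have key := integral_integral_swap hfi
  have hL : ∀ z, ∫ ξ, f z ξ = (((δ ^ n)⁻¹ * Real.exp (-(Real.pi * ‖z.1 - z.2‖ ^ 2 / δ ^ 2)) : ℝ) : ℂ) :=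
    fun z => gauss_id δ hδ z.1 z.2
  have hR : ∀ ξ, ∫ z, f z ξ ∂(μ.prod lam) =
      ((Real.exp (-(Real.pi * δ ^ 2) * ‖ξ‖ ^ 2) : ℝ) : ℂ) *
        (mft μ ξ * (starRingEnd ℂ) (mft lam ξ)) := by
    intro ξ
    simp only [hf]
    rw [integral_const_mul, integral_prod_mul (fun x => Complex.exp ((((-(2 * Real.pi * (inner ℝ x ξ : ℝ))) : ℝ) : ℂ) * Complex.I)) (fun x => Complex.exp ((((2 * Real.pi * (inner ℝ x ξ : ℝ)) : ℝ) : ℂ) * Complex.I)), mft_conj]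
    rfl
  simp_rw [hL, hR] at key
  rw [integral_complex_ofReal] at key
  have h0 : (∫ z : EuclideanSpace ℝ (Fin n) × EuclideanSpace ℝ (Fin n),
      (δ ^ n)⁻¹ * Real.exp (-(Real.pi * ‖z.1 - z.2‖ ^ 2 / δ ^ 2)) ∂(μ.prod lam)) ≤
      ‖((∫ z : EuclideanSpace ℝ (Fin n) × EuclideanSpace ℝ (Fin n),
      (δ ^ n)⁻¹ * Real.exp (-(Real.pi * ‖z.1 - z.2‖ ^ 2 / δ ^ 2)) ∂(μ.prod lam) : ℝ) : ℂ)‖ := by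
    rw [Complex.norm_real]; exact le_abs_self _
  refine h0.trans ?_
  rw [key]
  refine norm_integral_le_of_norm_le hint (Eventually.of_forall fun ξ => ?_)
  rw [norm_mul, norm_mul, RCLike.norm_conj, Complex.norm_real, Real.norm_eq_abs,
    abs_of_pos (Real.exp_pos _)]
  refine mul_le_of_le_one_left (by positivity) ?_
  rw [Real.exp_le_one_iff]
  have : 0 ≤ Real.pi * δ ^ 2 * ‖ξ‖ ^ 2 := by positivity
  linarith

lemma energy_int {n : ℕ} (μ lam : Measure (EuclideanSpace ℝ (Fin n)))
    [IsProbabilityMeasure μ] [IsProbabilityMeasure lam]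
    (σ : ℝ) (hσ : 0 < σ) (κ : ℝ) (hκ : (n : ℝ) - σ < κ)
    (C₁ : ℝ) (hC₁ : 0 < C₁)
    (hdecay : ∀ ξ : EuclideanSpace ℝ (Fin n), ξ ≠ 0 → ‖mft μ ξ‖ ≤ C₁ * ‖ξ‖ ^ (-σ))
    (C₂ : ℝ) (hC₂ : 0 < C₂)
    (hlam : ∀ R : ℝ, 1 ≤ R →
      ∫ ξ in Metric.closedBall (0 : EuclideanSpace ℝ (Fin n)) R, ‖mft lam ξ‖ ≤
        C₂ * R ^ ((n : ℝ) - κ)) :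
    Integrable (fun ξ => ‖mft μ ξ‖ * ‖mft lam ξ‖) := by
  have hcμ := mft_cont μ
  have hcl := mft_cont lam
  have hc : Continuous (fun ξ => ‖mft μ ξ‖ * ‖mft lam ξ‖) := by fun_prop
  let A : ℕ → Set (EuclideanSpace ℝ (Fin n)) := fun j =>
    {ξ | (2:ℝ) ^ j ≤ ‖ξ‖} ∩ Metric.closedBall 0 (2 ^ (j + 1))
  have hcov : (univ : Set (EuclideanSpace ℝ (Fin n))) ⊆ Metric.closedBall 0 1 ∪ ⋃ j, A j := by
    intro ξ _
    by_cases h : ‖ξ‖ ≤ 1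
    · left; simpa using h
    · right
      push Not at h
      obtain ⟨k, hk1, hk2⟩ := exists_nat_pow_near h.le (by norm_num : (1:ℝ) < 2)
      exact mem_iUnion.2 ⟨k, hk1, by simpa using hk2.le⟩
  have hAm : ∀ j, MeasurableSet (A j) := fun j =>
    (measurableSet_le measurable_const measurable_norm).inter measurableSet_closedBall
  have hlint : ∀ R : ℝ, 1 ≤ R → ∫⁻ ξ in Metric.closedBall (0 : EuclideanSpace ℝ (Fin n)) R,
      ENNReal.ofReal ‖mft lam ξ‖ ≤ ENNReal.ofReal (C₂ * R ^ ((n : ℝ) - κ)) := by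
    intro R hR
    rw [← ofReal_integral_eq_lintegral_ofReal]
    · exact ENNReal.ofReal_le_ofReal (hlam R hR)
    · exact (hcl.norm.continuousOn.integrableOn_compact (isCompact_closedBall _ _))
    · exact Eventually.of_forall fun _ => norm_nonneg _
  have hA : ∀ j, ∫⁻ ξ in A j, ENNReal.ofReal (‖mft μ ξ‖ * ‖mft lam ξ‖) ≤
      ENNReal.ofReal ((C₁ * C₂ * 2 ^ ((n : ℝ) - κ)) * ((2:ℝ) ^ ((n : ℝ) - κ - σ)) ^ j) := by
    intro j
    have h2 : (1:ℝ) ≤ 2 ^ j := one_le_pow₀ (by norm_num)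
    calc _ ≤ ∫⁻ ξ in A j, ENNReal.ofReal (C₁ * (2 ^ j) ^ (-σ)) * ENNReal.ofReal ‖mft lam ξ‖ := by
          refine setLIntegral_mono' (hAm j) fun ξ hξ => ?_
          rw [← ENNReal.ofReal_mul (by positivity)]
          refine ENNReal.ofReal_le_ofReal (mul_le_mul_of_nonneg_right ?_ (norm_nonneg _))
          have h3 : (2:ℝ) ^ j ≤ ‖ξ‖ := hξ.1
          have : ξ ≠ 0 := by
            rw [← norm_pos_iff]; linarith
          refine (hdecay ξ this).trans (mul_le_mul_of_nonneg_left ?_ hC₁.le)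
          exact Real.rpow_le_rpow_of_nonpos (by positivity) h3 (by linarith)
      _ = ENNReal.ofReal (C₁ * (2 ^ j) ^ (-σ)) * ∫⁻ ξ in A j, ENNReal.ofReal ‖mft lam ξ‖ := by
          rw [lintegral_const_mul]
          exact hcl.norm.measurable.ennreal_ofReal
      _ ≤ ENNReal.ofReal (C₁ * (2 ^ j) ^ (-σ)) *
            ENNReal.ofReal (C₂ * (2 ^ (j + 1)) ^ ((n : ℝ) - κ)) := by
          gcongr
          refine (lintegral_mono_set inter_subset_right).trans (hlint _ ?_)
          exact one_le_pow₀ (by norm_num)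
      _ = _ := by
          rw [← ENNReal.ofReal_mul (by positivity)]
          congr 1
          rw [← Real.rpow_natCast 2 j, ← Real.rpow_natCast 2 (j + 1), ← Real.rpow_natCast _ j,
            ← Real.rpow_mul (by norm_num), ← Real.rpow_mul (by norm_num),
            ← Real.rpow_mul (by norm_num)]
          rw [show C₁ * (2:ℝ) ^ (↑j * -σ) * (C₂ * 2 ^ (((j + 1 : ℕ) : ℝ) * (↑n - κ))) =
            C₁ * C₂ * (2 ^ (↑j * -σ) * 2 ^ (((j + 1 : ℕ) : ℝ) * (↑n - κ))) by ring,
            mul_assoc (C₁ * C₂), ← Real.rpow_add (by norm_num), ← Real.rpow_add (by norm_num)]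
          congr 2
          push_cast; ring
  have hr : (2:ℝ) ^ ((n : ℝ) - κ - σ) < 1 :=
    Real.rpow_lt_one_of_one_lt_of_neg (by norm_num) (by linarith)
  have hsum : Summable (fun j : ℕ =>
      (C₁ * C₂ * 2 ^ ((n : ℝ) - κ)) * ((2:ℝ) ^ ((n : ℝ) - κ - σ)) ^ j) :=
    (summable_geometric_of_lt_one (by positivity) hr).mul_left _
  refine ⟨hc.aestronglyMeasurable, ?_⟩
  rw [hasFiniteIntegral_iff_ofReal (Eventually.of_forall fun _ => by positivity)]
  rw [← setLIntegral_univ]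
  refine (lintegral_mono_set hcov).trans_lt ((lintegral_union_le _ _ _).trans_lt ?_)
  refine ENNReal.add_lt_top.2 ⟨?_, ?_⟩
  · have := (hc.continuousOn.integrableOn_compact (μ := volume)
      (isCompact_closedBall (0 : EuclideanSpace ℝ (Fin n)) 1)).2
    rwa [hasFiniteIntegral_iff_ofReal (Eventually.of_forall fun _ => by positivity)] at this
  · refine (lintegral_iUnion_le _ _).trans_lt ((ENNReal.tsum_le_tsum hA).trans_lt ?_)
    rw [← ENNReal.ofReal_tsum_of_nonneg (fun j => by positivity) hsum]
    exact ENNReal.ofReal_lt_top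

lemma exists_cover {X : Type*} [PseudoMetricSpace X] (F : Set X) (δ B : ℝ) (hδ : 0 ≤ δ)
    (h : ∀ S : Finset X, (S : Set X) ⊆ F →
      ((S : Set X).Pairwise fun x y => δ < dist x y) → (S.card : ℝ) ≤ B) :
    ∃ S : Finset X, (S.card : ℝ) ≤ B ∧ F ⊆ ⋃ x ∈ S, Metric.closedBall x δ := by
  classical
  let P : ℕ → Prop := fun k => ∃ S : Finset X, S.card = k ∧ (S : Set X) ⊆ F ∧
      ((S : Set X).Pairwise fun x y => δ < dist x y)
  have hP : ∀ k, P k → k ≤ ⌊B⌋₊ := by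
    rintro k ⟨S, rfl, h1, h2⟩
    exact Nat.le_floor (h S h1 h2)
  have h0 : P 0 := ⟨∅, by simp⟩
  obtain ⟨S, hS, h1, h2⟩ := Nat.findGreatest_spec (P := P) (Nat.zero_le ⌊B⌋₊) h0
  refine ⟨S, h S h1 h2, fun x hx => ?_⟩
  by_contra hcon
  simp only [mem_iUnion, Metric.mem_closedBall, not_exists, not_le] at hcon
  have hxS : x ∉ S := fun hxS => by
    have := hcon x hxS
    rw [dist_self] at this; linarith
  have hPn : P (S.card + 1) := by
    refine ⟨insert x S, Finset.card_insert_of_notMem hxS, ?_, ?_⟩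
    · rw [Finset.coe_insert]; exact insert_subset hx h1
    · rw [Finset.coe_insert]
      refine h2.insert fun y hy _ => ⟨hcon y hy, ?_⟩
      rw [dist_comm]; exact hcon y hy
  have := Nat.le_findGreatest (hP _ hPn) hPn
  omega

lemma count_le {n : ℕ} (m : ℝ) (s : ℝ)
    (μ lam : Measure (EuclideanSpace ℝ (Fin n)))
    [IsProbabilityMeasure μ] [IsProbabilityMeasure lam]
    (c : ℝ) (hc : 0 < c)
    (hreg : ∀ x ∈ msupp μ, ∀ r : ℝ, 0 < r → r ≤ 1 →
      ENNReal.ofReal (c * r ^ m) ≤ μ (Metric.closedBall x r))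
    (C : ℝ) (hC : 1 < C)
    (hAD : ∀ x ∈ msupp lam, ∀ r : ℝ, 0 < r → r ≤ 1 →
      ENNReal.ofReal (C⁻¹ * r ^ s) ≤ lam (Metric.closedBall x r))
    (hint : Integrable (fun ξ => ‖mft μ ξ‖ * ‖mft lam ξ‖)) (δ : ℝ) (hδ : 0 < δ) (hδ1 : δ < 1)
    (S : Finset (EuclideanSpace ℝ (Fin n)))
    (hS : (S : Set (EuclideanSpace ℝ (Fin n))) ⊆ Metric.cthickening δ (msupp μ) ∩ msupp lam)
    (hsep : (S : Set (EuclideanSpace ℝ (Fin n))).Pairwise fun x y => δ < dist x y) :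
    (S.card : ℝ) * ((δ ^ n)⁻¹ * Real.exp (-(16 * Real.pi)) *
      ((c * δ ^ m) * (C⁻¹ * (δ / 2) ^ s))) ≤ ∫ ξ, ‖mft μ ξ‖ * ‖mft lam ξ‖ := by
  have hz : ∀ x : EuclideanSpace ℝ (Fin n), ∃ z, x ∈ S → z ∈ msupp μ ∧ dist x z < 2 * δ := by
    intro x
    by_cases hx : x ∈ S
    · have h1 := Metric.cthickening_subset_thickening' (by linarith) (by linarith : δ < 2 * δ) _
        (hS hx).1
      obtain ⟨z, hz, hd⟩ := Metric.mem_thickening_iff.1 h1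
      exact ⟨z, fun _ => ⟨hz, hd⟩⟩
    · exact ⟨x, fun h => absurd h hx⟩
  choose z hz using hz
  refine le_trans ?_ (gauss_le μ lam hint δ hδ)
  set g : EuclideanSpace ℝ (Fin n) × EuclideanSpace ℝ (Fin n) → ℝ := fun p =>
    (δ ^ n)⁻¹ * Real.exp (-(Real.pi * ‖p.1 - p.2‖ ^ 2 / δ ^ 2)) with hg
  have hgc : Continuous g := by fun_prop
  have hg0 : ∀ p, 0 ≤ g p := fun p => by positivity
  have hgi : Integrable g (μ.prod lam) := by
    refine (integrable_const ((δ ^ n)⁻¹)).mono' hgc.aestronglyMeasurable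
      (Eventually.of_forall fun p => ?_)
    rw [Real.norm_eq_abs, abs_of_nonneg (hg0 p)]
    refine mul_le_of_le_one_right (by positivity) ?_
    rw [Real.exp_le_one_iff]
    have : 0 ≤ Real.pi * ‖p.1 - p.2‖ ^ 2 / δ ^ 2 := by positivity
    linarith
  let A : EuclideanSpace ℝ (Fin n) → Set (EuclideanSpace ℝ (Fin n) × EuclideanSpace ℝ (Fin n)) :=
    fun x => Metric.closedBall (z x) δ ×ˢ Metric.closedBall x (δ / 2)
  have hAm : ∀ x, MeasurableSet (A x) := fun x =>
    measurableSet_closedBall.prod measurableSet_closedBall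
  have hdisj : (S : Set (EuclideanSpace ℝ (Fin n))).Pairwise (Function.onFun Disjoint A) := by
    intro x hx y hy hxy
    refine Set.disjoint_left.2 fun p hp hq => ?_
    have h1 : dist p.2 x ≤ δ / 2 := hp.2
    have h2 : dist p.2 y ≤ δ / 2 := hq.2
    have h3 := hsep hx hy hxy
    have h4 := dist_triangle_left x y p.2
    linarith
  have step : ∀ x ∈ S, (δ ^ n)⁻¹ * Real.exp (-(16 * Real.pi)) *
      ((c * δ ^ m) * (C⁻¹ * (δ / 2) ^ s)) ≤ ∫ p in A x, g p ∂(μ.prod lam) := by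
    intro x hx
    obtain ⟨hzs, hzd⟩ := hz x hx
    have h1 : c * δ ^ m ≤ μ.real (Metric.closedBall (z x) δ) :=
      (ENNReal.ofReal_le_iff_le_toReal (measure_ne_top _ _)).1 (hreg _ hzs δ hδ hδ1.le)
    have h2 : C⁻¹ * (δ / 2) ^ s ≤ lam.real (Metric.closedBall x (δ / 2)) :=
      (ENNReal.ofReal_le_iff_le_toReal (measure_ne_top _ _)).1
        (hAD _ (hS hx).2 (δ / 2) (by linarith) (by linarith))
    have h3 : (c * δ ^ m) * (C⁻¹ * (δ / 2) ^ s) ≤ (μ.prod lam).real (A x) := by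
      rw [measureReal_prod_prod]
      exact mul_le_mul h1 h2 (by positivity) (by positivity)
    refine (mul_le_mul_of_nonneg_left h3 (by positivity)).trans ?_
    refine setIntegral_ge_of_const_le_real (hAm x) (measure_ne_top _ _) ?_ hgi.integrableOn
    intro p hp
    have e1 : dist p.1 (z x) ≤ δ := hp.1
    have e2 : dist p.2 x ≤ δ / 2 := hp.2
    have e3 : ‖p.1 - p.2‖ ≤ 4 * δ := by
      rw [← dist_eq_norm]
      have t1 := dist_triangle p.1 (z x) p.2
      have t2 := dist_triangle (z x) x p.2
      rw [dist_comm (z x) x, dist_comm x p.2] at t2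
      linarith
    refine mul_le_mul_of_nonneg_left (Real.exp_le_exp.2 ?_) (by positivity)
    rw [neg_le_neg_iff, div_le_iff₀ (by positivity)]
    have := pow_le_pow_left₀ (norm_nonneg _) e3 2
    nlinarith [Real.pi_pos]
  calc _ = ∑ x ∈ S, (δ ^ n)⁻¹ * Real.exp (-(16 * Real.pi)) *
      ((c * δ ^ m) * (C⁻¹ * (δ / 2) ^ s)) := by rw [Finset.sum_const, nsmul_eq_mul]
    _ ≤ ∑ x ∈ S, ∫ p in A x, g p ∂(μ.prod lam) := Finset.sum_le_sum step
    _ = ∫ p in ⋃ x ∈ S, A x, g p ∂(μ.prod lam) :=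
        (integral_biUnion_finset S (fun x _ => hAm x) hdisj (fun x _ => hgi.integrableOn)).symm
    _ ≤ _ := setIntegral_le_integral hgi (Eventually.of_forall hg0)

lemma boxdim_le {X : Type*} [PseudoMetricSpace X] (F : Set X) (t C : ℝ) (hC : 0 < C)
    (h : ∀ δ : ℝ, 0 < δ → δ < 1 → ∃ S : Finset X, (S.card : ℝ) ≤ C * δ ^ (-t) ∧
      F ⊆ ⋃ x ∈ S, Metric.closedBall x δ) : upperBoxDim F ≤ max 0 t := by
  have hev : ∀ᶠ δ : ℝ in nhdsWithin 0 (Set.Ioi (0 : ℝ)), 0 < δ ∧ δ < 1 :=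
    Ioo_mem_nhdsGT one_pos
  have hlog : Tendsto (fun δ : ℝ => Real.log (1 / δ)) (nhdsWithin 0 (Set.Ioi (0 : ℝ))) atTop := by
    simp only [one_div]
    exact Real.tendsto_log_atTop.comp tendsto_inv_nhdsGT_zero
  refine le_of_forall_pos_le_add fun ε hε => ?_
  refine limsup_le_of_le ?_ ?_
  · refine IsCoboundedUnder.of_frequently_ge (a := 0) (Eventually.frequently ?_)
    filter_upwards [hev] with δ hδ
    refine div_nonneg (Real.log_natCast_nonneg _) (Real.log_nonneg ?_)
    rw [le_div_iff₀ hδ.1]; linarith [hδ.2]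
  · filter_upwards [hev, hlog.eventually_ge_atTop (|Real.log C| / ε), hlog.eventually_gt_atTop 0]
      with δ hδ h1 h2
    rw [div_le_iff₀ h2]
    rw [div_le_iff₀ hε] at h1
    have hm : 0 ≤ max 0 t * Real.log (1 / δ) := mul_nonneg (le_max_left _ _) h2.le
    rcases Nat.eq_zero_or_pos (coverNum F δ) with h0 | h0
    · rw [h0]; simp only [Nat.cast_zero, Real.log_zero]
      nlinarith
    · obtain ⟨S, hS, hF⟩ := h δ hδ.1 hδ.2
      have hle : coverNum F δ ≤ S.card := Nat.sInf_le ⟨S, rfl, hF⟩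
      have hle' : (coverNum F δ : ℝ) ≤ C * δ ^ (-t) :=
        le_trans (by exact_mod_cast hle) hS
      have h3 := Real.log_le_log (by exact_mod_cast h0) hle'
      rw [Real.log_mul hC.ne' (Real.rpow_pos_of_pos hδ.1 _).ne', Real.log_rpow hδ.1] at h3
      have h4 : Real.log (1 / δ) = - Real.log δ := by rw [one_div, Real.log_inv]
      have h5 : t * Real.log (1 / δ) ≤ max 0 t * Real.log (1 / δ) :=
        mul_le_mul_of_nonneg_right (le_max_right _ _) h2.le
      have h6 := le_abs_self (Real.log C)
      rw [h4] at h1 h5 ⊢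
      nlinarith


/-- under polynomial Fourier decay of `μ`, lower `m`-regularity of `μ`, and
AD-regularity (exponent `s`) plus the `l¹`-type Fourier bound for `λ`, the set
`(supp μ)^δ ∩ supp λ` can be covered by `C·δ^{-(s-(n-m))}` closed `δ`-balls; in particular
the upper box dimension of `supp μ ∩ supp λ` is at most `max 0 (s - (n - m))`. -/
theorem statement3 (n : ℕ) (hn : 1 ≤ n) (m : ℝ) (hm0 : 0 < m) (hmn : m < n)
    (σ : ℝ) (hσ : 0 < σ) (κ : ℝ) (hκ : (n : ℝ) - σ < κ)
    (s : ℝ) (hs0 : 0 < s) (hsn : s ≤ n)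
    (μ lam : Measure (EuclideanSpace ℝ (Fin n)))
    [IsProbabilityMeasure μ] [IsProbabilityMeasure lam]
    (hμcpt : ∃ K : Set (EuclideanSpace ℝ (Fin n)), IsCompact K ∧ μ Kᶜ = 0)
    (C₁ c : ℝ) (hC₁ : 0 < C₁) (hc : 0 < c)
    (hdecay : ∀ ξ : EuclideanSpace ℝ (Fin n), ξ ≠ 0 → ‖mft μ ξ‖ ≤ C₁ * ‖ξ‖ ^ (-σ))
    (hreg : ∀ x ∈ msupp μ, ∀ r : ℝ, 0 < r → r ≤ 1 →
      ENNReal.ofReal (c * r ^ m) ≤ μ (Metric.closedBall x r))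
    (hAD : ADRegular lam s)
    (C₂ : ℝ) (hC₂ : 0 < C₂)
    (hlam : ∀ R : ℝ, 1 ≤ R →
      ∫ ξ in Metric.closedBall (0 : EuclideanSpace ℝ (Fin n)) R, ‖mft lam ξ‖ ≤
        C₂ * R ^ ((n : ℝ) - κ)) :
    (∃ C : ℝ, 0 < C ∧ ∀ δ : ℝ, 0 < δ → δ < 1 →
        ∃ S : Finset (EuclideanSpace ℝ (Fin n)),
          (S.card : ℝ) ≤ C * δ ^ (-(s - ((n : ℝ) - m))) ∧
          Metric.cthickening δ (msupp μ) ∩ msupp lam ⊆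
            ⋃ x ∈ S, Metric.closedBall x δ) ∧
      upperBoxDim (msupp μ ∩ msupp lam) ≤ max 0 (s - ((n : ℝ) - m)) := by
  have hint := energy_int μ lam σ hσ κ hκ C₁ hC₁ hdecay C₂ hC₂ hlam
  obtain ⟨D, hD, hAD⟩ := hAD
  have hM : 0 ≤ ∫ ξ, ‖mft μ ξ‖ * ‖mft lam ξ‖ := integral_nonneg fun ξ => by positivity
  set M := ∫ ξ, ‖mft μ ξ‖ * ‖mft lam ξ‖ with hMdef
  have hD0 : 0 < D := by linarith
  set a : ℝ := Real.exp (-(16 * Real.pi)) * c * D⁻¹ * (2 ^ s)⁻¹ with ha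
  have ha0 : 0 < a := by positivity
  have main : ∃ C : ℝ, 0 < C ∧ ∀ δ : ℝ, 0 < δ → δ < 1 →
        ∃ S : Finset (EuclideanSpace ℝ (Fin n)),
          (S.card : ℝ) ≤ C * δ ^ (-(s - ((n : ℝ) - m))) ∧
          Metric.cthickening δ (msupp μ) ∩ msupp lam ⊆
            ⋃ x ∈ S, Metric.closedBall x δ := by
    refine ⟨(M + 1) / a, by positivity, fun δ hδ hδ1 => ?_⟩
    refine exists_cover _ δ _ hδ.le fun S hS hsep => ?_
    have h := count_le m s μ lam c hc hreg D hD (fun x hx r h1 h2 => (hAD x hx r h1 h2).1)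
      hint δ hδ hδ1 S hS hsep
    rw [← hMdef] at h
    have e : (δ ^ n)⁻¹ * Real.exp (-(16 * Real.pi)) * ((c * δ ^ m) * (D⁻¹ * (δ / 2) ^ s)) =
        a * δ ^ (s - ((n : ℝ) - m)) := by
      rw [show s - ((n : ℝ) - m) = s + m - n by ring, Real.rpow_sub hδ, Real.rpow_add hδ,
        Real.rpow_natCast, Real.div_rpow hδ.le (by norm_num), ha]
      field_simp
    have hp : 0 < δ ^ (s - ((n : ℝ) - m)) := Real.rpow_pos_of_pos hδ _
    rw [e] at h
    rw [Real.rpow_neg hδ.le, ← div_eq_mul_inv, div_div, le_div_iff₀ (by positivity)]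
    linarith
  refine ⟨main, ?_⟩
  obtain ⟨C, hC, h⟩ := main
  refine boxdim_le _ _ C hC fun δ hδ hδ1 => ?_
  obtain ⟨S, hS, hF⟩ := h δ hδ hδ1
  exact ⟨S, hS, fun x hx => hF ⟨Metric.self_subset_cthickening _ hx.1, hx.2⟩⟩
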